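/- arXiv:1111.2087 — 2 statements merged into one kernel-verified Lean document; each statement's English description precedes it below -/
import Mathlib

section
/- The reduction endofunctor of the category of commutative rings, sending A to A ⧸ nilradical A (and a ring homomorphism to the induced homomorphism on quotients), preserves filtered colimits. Equivalently, for a filtered diagram of commutative rings (R_i) with colimit R, the canonical map colim_i (R_i ⧸ nilradical R_i) → R ⧸ nilradical R is an isomorphism. -/
/-!
STATEMENT 1: The reduction endofunctor of the category of commutative rings,
sending `A` to `A ⧸ nilradical A` (and a ring homomorphism to the induced
homomorphism on quotients), preserves filtered colimits.
-/

open CategoryTheory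

universe u

/-- The homomorphism `A ⧸ nilradical A →+* B ⧸ nilradical B` induced by `f : A →+* B`. -/
noncomputable def nilradicalQuotientMap {A B : Type u} [CommRing A] [CommRing B]
    (f : A →+* B) : A ⧸ nilradical A →+* B ⧸ nilradical B :=
  Ideal.quotientMap (nilradical B) f
    (fun x hx => Ideal.mem_comap.mpr (mem_nilradical.mpr ((mem_nilradical.mp hx).map f)))

/-- The reduction endofunctor `A ↦ A ⧸ nilradical A` of the category of commutative rings. -/
noncomputable def reductionFunctor : CommRingCat.{u} ⥤ CommRingCat.{u} where
  obj A := CommRingCat.of (A ⧸ nilradical A)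
  map {A B} f := CommRingCat.ofHom (nilradicalQuotientMap f.hom)
  map_id A := by
    apply CommRingCat.hom_ext
    apply Ideal.Quotient.ringHom_ext
    ext x
    rfl
  map_comp {A B C} f g := by
    apply CommRingCat.hom_ext
    apply Ideal.Quotient.ringHom_ext
    ext x
    rfl

open Limits in
/-- An element of a ring in a filtered diagram that becomes nilpotent in the colimit is already
nilpotent at a later stage of the diagram. -/
theorem exists_isNilpotent_map_of_isColimit {J : Type u} [SmallCategory J] [IsFiltered J]
    {F : J ⥤ CommRingCat.{u}} {c : Cocone F} (hc : IsColimit c) {i : J} {a : F.obj i}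
    (ha : IsNilpotent ((c.ι.app i).hom a)) :
    ∃ (j : J) (f : i ⟶ j), IsNilpotent ((F.map f).hom a) := by
  obtain ⟨n, hn⟩ := ha
  obtain ⟨j, f, hf⟩ := (IsColimit.eq_iff' hc (a ^ n) 0).mp
    (show (c.ι.app i).hom (a ^ n) = (c.ι.app i).hom 0 by rw [map_pow, hn, map_zero])
  refine ⟨j, f, n, ?_⟩
  rw [← map_pow]
  exact hf.trans (map_zero (F.map f).hom)

/-- The reduction endofunctor preserves filtered colimits. -/
theorem reductionFunctor_preservesFilteredColimits :
    Nonempty (Limits.PreservesFilteredColimits reductionFunctor.{u}) := by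
  refine ⟨⟨fun J _ _ => ⟨fun {F} => ⟨fun {c} hc => ?_⟩⟩⟩⟩
  have : Limits.ReflectsColimitsOfShape J (forget CommRingCat.{u}) :=
    Limits.reflectsColimitsOfShape_of_reflectsIsomorphisms
  refine ⟨Limits.isColimitOfReflects (forget CommRingCat.{u})
    (Limits.Types.FilteredColimit.isColimitOf' _ _ ?_ ?_)⟩
  · intro x
    obtain ⟨r, rfl⟩ := Ideal.Quotient.mk_surjective (I := nilradical c.pt) x
    obtain ⟨i, a, rfl⟩ := Limits.Concrete.isColimit_exists_rep F hc r
    exact ⟨i, Ideal.Quotient.mk _ a, rfl⟩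
  · intro i x y hxy
    obtain ⟨a, rfl⟩ := Ideal.Quotient.mk_surjective (I := nilradical (F.obj i)) x
    obtain ⟨b, rfl⟩ := Ideal.Quotient.mk_surjective (I := nilradical (F.obj i)) y
    have hab : (c.ι.app i).hom a - (c.ι.app i).hom b ∈ nilradical c.pt :=
      Ideal.Quotient.eq.mp hxy
    rw [← map_sub] at hab
    obtain ⟨j, f, hf⟩ := exists_isNilpotent_map_of_isColimit hc (mem_nilradical.mp hab)
    rw [map_sub, ← mem_nilradical] at hf
    exact ⟨j, f, Ideal.Quotient.eq.mpr hf⟩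
end

section
/- If a classical prestack Y : CommRing ⥤ Type preserves filtered colimits, then its de Rham prestack Y_dR, defined by Y_dR(R) := Y(red R), also preserves filtered colimits. -/
/-!
STATEMENT 3: If a classical prestack `Y : CommRing ⥤ Type` preserves filtered
colimits, then its de Rham prestack `Y_dR`, defined by `Y_dR(R) := Y(red R)`,
also preserves filtered colimits.
-/

open CategoryTheory

universe u

/-- The projection `A ⟶ A ⧸ nilradical A`, natural in `A`. -/
noncomputable def reductionProjection : 𝟭 CommRingCat.{u} ⟶ reductionFunctor.{u} where
  app A := CommRingCat.ofHom (Ideal.Quotient.mk (nilradical A))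
  naturality _ _ _ := rfl

/-- Morphisms out of the reduction of a ring are determined on the ring itself. -/
lemma reduction_hom_ext {A B : CommRingCat.{u}} {f g : reductionFunctor.obj A ⟶ B}
    (h : reductionProjection.app A ≫ f = reductionProjection.app A ≫ g) : f = g :=
  CommRingCat.hom_ext (Ideal.Quotient.ringHom_ext (congrArg CommRingCat.Hom.hom h))

/-- A nilpotent element of a filtered colimit of rings lifts to a nilpotent element of some
ring of the diagram. -/
lemma exists_isNilpotent_of_isColimit {J : Type u} [SmallCategory J] [IsFiltered J]
    {F : J ⥤ CommRingCat.{u}} {c : Limits.Cocone F} (hc : Limits.IsColimit c) {x : c.pt}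
    (hx : IsNilpotent x) : ∃ (j : J) (y : F.obj j), IsNilpotent y ∧ c.ι.app j y = x := by
  obtain ⟨n, hn⟩ := hx
  obtain ⟨i, y, rfl⟩ := Limits.Concrete.isColimit_exists_rep F hc x
  have h : c.ι.app i (y ^ n) = c.ι.app i 0 := by rw [map_pow, hn, map_zero]
  obtain ⟨j, f, g, hfg⟩ := Limits.Concrete.isColimit_exists_of_rep_eq F hc _ _ h
  refine ⟨j, F.map f y, ⟨n, ?_⟩, ?_⟩
  · rw [← map_pow, hfg, map_zero]
  · rw [← c.w f]
    rfl

/-- Reduction preserves filtered colimits of rings. -/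
instance reductionFunctor_preservesFilteredColimits_s3 :
    Limits.PreservesFilteredColimits reductionFunctor.{u} where
  preserves_filtered_colimits J _ _ := ⟨fun {F} => ⟨fun {c} hc => by
    let t (s : Limits.Cocone (F ⋙ reductionFunctor)) : Limits.Cocone F :=
      { pt := s.pt
        ι := Functor.whiskerLeft F reductionProjection ≫ s.ι }
    have ht (s : Limits.Cocone (F ⋙ reductionFunctor)) (x : c.pt) (hx : x ∈ nilradical c.pt) :
        (hc.desc (t s)).hom x = 0 := by
      obtain ⟨j, y, hy, rfl⟩ := exists_isNilpotent_of_isColimit hc (mem_nilradical.mp hx)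
      have hmk : Ideal.Quotient.mk (nilradical (F.obj j)) y = 0 :=
        Ideal.Quotient.eq_zero_iff_mem.mpr (mem_nilradical.mpr hy)
      exact (ConcreteCategory.congr_hom (hc.fac (t s) j) y).trans
        ((congrArg (s.ι.app j).hom hmk).trans (map_zero (s.ι.app j).hom))
    exact ⟨{
      desc := fun s => CommRingCat.ofHom (Ideal.Quotient.lift (nilradical c.pt) _ (ht s))
      fac := fun s j => reduction_hom_ext (hc.fac (t s) j)
      uniq := fun s m hm => reduction_hom_ext <|
        hc.uniq (t s) (reductionProjection.app c.pt ≫ m) fun j =>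
          congrArg (reductionProjection.app (F.obj j) ≫ ·) (hm j) }⟩⟩⟩

/-- If a classical prestack `Y` preserves filtered colimits, then so does its
de Rham prestack `Y_dR = red ⋙ Y`. -/
theorem deRham_preservesFilteredColimits (Y : CommRingCat.{u} ⥤ Type u)
    (hY : Nonempty (Limits.PreservesFilteredColimits Y)) :
    Nonempty (Limits.PreservesFilteredColimits (reductionFunctor.{u} ⋙ Y)) := by
  obtain ⟨_⟩ := hY
  exact ⟨inferInstance⟩
end
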